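/- The graph D₁ is not word-representable, where D₁ is the split graph with vertex set {1,2,3,4,5,6} ∪ {a,b,c,d}, in which {1,2,3,4,5,6} induces a complete graph (a clique K₆), {a,b,c,d} is an independent set, and the remaining edges are exactly: a adjacent to 1, 3, 5; b adjacent to 1, 2; c adjacent to 3, 4; d adjacent to 5, 6. -/

import Mathlib

/-- Two distinct letters `x` and `y` alternate in a word `w` if the subsequence of `w`
obtained by deleting all letters other than `x` and `y` has no two equal consecutive
letters (i.e. it is of the form `xyxy...` or `yxyx...`). -/
def Alternates {V : Type*} [DecidableEq V] (w : List V) (x y : V) : Prop :=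
  (w.filter fun z => decide (z = x ∨ z = y)).Chain' (· ≠ ·)

/-- `w` is a word representing the graph `G`: every vertex occurs in `w`, and two distinct
vertices alternate in `w` iff they are adjacent in `G`. -/
def WordRepresents {V : Type*} [DecidableEq V] (G : SimpleGraph V) (w : List V) : Prop :=
  (∀ v : V, v ∈ w) ∧ ∀ x y : V, x ≠ y → (Alternates w x y ↔ G.Adj x y)

/-- A graph is word-representable if some word represents it. -/
def WordRepresentable {V : Type*} [DecidableEq V] (G : SimpleGraph V) : Prop :=
  ∃ w : List V, WordRepresents G w
/-- Neighborhoods in the clique `{1,…,6}` (represented by `Fin 6`, with vertex `i+1`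
represented by `i`) of the independent vertices `a, b, c, d` (represented by `Fin 4`):
`a` is adjacent to `1,3,5`; `b` to `1,2`; `c` to `3,4`; `d` to `5,6`. -/
def D1nbr : Fin 4 → Finset (Fin 6)
  | 0 => {0, 2, 4}
  | 1 => {0, 1}
  | 2 => {2, 3}
  | 3 => {4, 5}

/-- The split graph `D₁`: the clique `{1,…,6}` (as `Fin 6`), the independent set
`{a,b,c,d}` (as `Fin 4`), and edges between them given by `D1nbr`. -/
def D1 : SimpleGraph (Fin 6 ⊕ Fin 4) :=
  SimpleGraph.fromRel fun u v =>
    match u, v with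
    | Sum.inl _, Sum.inl _ => True
    | Sum.inl i, Sum.inr a => i ∈ D1nbr a
    | _, _ => False

/-- In every prefix of `w`, the letter `x` occurs as often as `y` or once more; equivalently,
`x` and `y` alternate in `w` and `y` does not come first. -/
def Leads {V : Type*} [DecidableEq V] (w : List V) (x y : V) : Prop :=
  ∀ u, u <+: w → u.count y ≤ u.count x ∧ u.count x ≤ u.count y + 1

section Leads

variable {V : Type*} [DecidableEq V] {w : List V} {p q r s x y : V}

theorem leads_cons {a : V} : Leads (a :: w) x y ↔ ∀ u, u <+: w →
    (a :: u).count y ≤ (a :: u).count x ∧ (a :: u).count x ≤ (a :: u).count y + 1 := by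
  refine ⟨fun h u hu => h _ (List.cons_prefix_cons.2 ⟨rfl, hu⟩), fun h u hu => ?_⟩
  rcases List.prefix_cons_iff.1 hu with rfl | ⟨t, rfl, ht⟩
  · simp
  · exact h t ht

theorem leads_iff_isChain (hxy : x ≠ y) :
    Leads w x y ↔ (y :: w.filter fun z => decide (z = x ∨ z = y)).IsChain (· ≠ ·) := by
  induction w generalizing x y with
  | nil => simp [Leads]
  | cons a w ih =>
    rw [leads_cons]
    by_cases hax : a = x
    · subst hax
      have h := ih hxy.symm
      simp only [or_comm] at h
      simp only [List.filter_cons, true_or, decide_true, if_true, List.isChain_cons_cons]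
      rw [← h]
      simp only [List.count_cons_self, List.count_cons_of_ne hxy, Leads]
      constructor
      · exact fun h => ⟨hxy.symm, fun u hu => by have := h u hu; omega⟩
      · exact fun h u hu => by have := h.2 u hu; omega
    · by_cases hay : a = y
      · subst hay
        simp only [List.filter_cons, or_true, decide_true, if_true, List.isChain_cons_cons]
        simp only [ne_eq, not_true_eq_false, false_and, iff_false]
        intro h
        have := (h [] List.nil_prefix).1
        simp [hax] at this
      · simp only [List.filter_cons, hax, hay, or_self, decide_false, Bool.false_eq_true, if_false]
        rw [← ih hxy]
        simp [Leads, List.count_cons_of_ne hax, List.count_cons_of_ne hay]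

theorem alternates_iff_leads (hxy : x ≠ y) :
    Alternates w x y ↔ Leads w x y ∨ Leads w y x := by
  have hF : ∀ a ∈ w.filter fun z => decide (z = x ∨ z = y), a = x ∨ a = y := by
    intro a ha
    simpa using (List.mem_filter.1 ha).2
  have hyx := leads_iff_isChain (w := w) hxy.symm
  simp only [or_comm (a := _ = y)] at hyx
  rw [leads_iff_isChain hxy, hyx]
  change List.IsChain _ _ ↔ _
  generalize (w.filter fun z => decide (z = x ∨ z = y)) = F at hF
  cases F with
  | nil => simp
  | cons a F =>
    simp only [List.isChain_cons_cons]
    rcases hF a (by simp) with rfl | rfl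
    · simp [hxy.symm]
    · simp [hxy]

theorem Leads.idxOf_le (hy : y ∈ w) (h : Leads w x y) : w.idxOf x ≤ w.idxOf y := by
  by_contra! hlt
  have hmem : y ∈ w.take (w.idxOf y + 1) := by
    rw [List.mem_take_iff_idxOf_lt hy]
    omega
  have hcount := (h _ (List.take_prefix (w.idxOf y + 1) w)).1
  have hx : x ∈ w.take (w.idxOf y + 1) :=
    List.count_pos_iff.1 ((List.count_pos_iff.2 hmem).trans_le hcount)
  rw [List.mem_take_iff_idxOf_lt (List.mem_of_mem_take hx)] at hx
  omega

theorem Alternates.leads_of_idxOf_lt (h : Alternates w x y) (hx : x ∈ w)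
    (hlt : w.idxOf x < w.idxOf y) : Leads w x y := by
  have hxy : x ≠ y := by
    rintro rfl
    exact hlt.false
  exact ((alternates_iff_leads hxy).1 h).resolve_right fun h' => (h'.idxOf_le hx).not_gt hlt

/-- A letter alternating with the first and third of four letters in cyclic order
alternates with the second or the fourth. -/
theorem alternates_second_or_fourth (hpq : Leads w p q) (hqr : Leads w q r) (hrs : Leads w r s)
    (hps : Leads w p s) (hp : Leads w x p ∨ Leads w p x) (hr : Leads w x r ∨ Leads w r x) :
    (Leads w x q ∨ Leads w q x) ∨ (Leads w x s ∨ Leads w s x) := by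
  rcases hp with hp | hp <;> rcases hr with hr | hr
  · refine .inl (.inl fun u hu => ?_)
    grind [Leads]
  · refine .inl (.inl fun u hu => ?_)
    grind [Leads]
  · refine .inr (.inl fun u hu => ?_)
    grind [Leads]
  · refine .inl (.inr fun u hu => ?_)
    grind [Leads]

/-- A letter alternating with the second and fourth of four letters in cyclic order
alternates with the first or the third. -/
theorem alternates_first_or_third (hpq : Leads w p q) (hqr : Leads w q r) (hrs : Leads w r s)
    (hps : Leads w p s) (hq : Leads w x q ∨ Leads w q x) (hs : Leads w x s ∨ Leads w s x) :
    (Leads w x p ∨ Leads w p x) ∨ (Leads w x r ∨ Leads w r x) := by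
  rcases hq with hq | hq <;> rcases hs with hs | hs
  · refine .inr (.inl fun u hu => ?_)
    grind [Leads]
  · refine .inr (.inl fun u hu => ?_)
    grind [Leads]
  · refine .inl (.inr fun u hu => ?_)
    grind [Leads]
  · refine .inr (.inr fun u hu => ?_)
    grind [Leads]

end Leads

/-- The pairs `{n, n'}` and `{m, m'}` do not separate each other in the cyclic order
induced by a linear order. -/
def NoCross {α : Type*} [LinearOrder α] (n n' m m' : α) : Prop :=
  ((n < m ↔ n' < m) ↔ (n < m' ↔ n' < m'))

theorem not_noCross {α : Type*} [LinearOrder α] {n n' m m' : α} (hm : n ≠ m) (hm' : n ≠ m')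
    (hn : n' ≠ m) (hn' : n' ≠ m') (h : ¬ NoCross n n' m m') :
    (n < m ∧ m < n' ∧ n' < m') ∨ (n < m' ∧ m' < n' ∧ n' < m) ∨
    (n' < m ∧ m < n ∧ n < m') ∨ (n' < m' ∧ m' < n ∧ n < m) ∨
    (m < n ∧ n < m' ∧ m' < n') ∨ (m' < n ∧ n < m ∧ m < n') ∨
    (m < n' ∧ n' < m' ∧ m' < n) ∨ (m' < n' ∧ n' < m ∧ m < n) := by
  unfold NoCross at h
  grind

theorem false_of_noCross_D1nbr {α : Type*} [LinearOrder α] (f : Fin 6 → α) (hf : Function.Injective f)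
    (h : ∀ k : Fin 4, ∀ n ∈ D1nbr k, ∀ n' ∈ D1nbr k, ∀ m ∉ D1nbr k, ∀ m' ∉ D1nbr k,
      NoCross (f n) (f n') (f m) (f m')) : False := by
  have b := h 1 0 (by decide) 1 (by decide) 2 (by decide) 4 (by decide)
  have c := h 2 2 (by decide) 3 (by decide) 0 (by decide) 4 (by decide)
  have d := h 3 4 (by decide) 5 (by decide) 0 (by decide) 2 (by decide)
  have a₁ := h 0 0 (by decide) 2 (by decide) 1 (by decide) 3 (by decide)
  have a₂ := h 0 0 (by decide) 2 (by decide) 3 (by decide) 5 (by decide)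
  have a₃ := h 0 0 (by decide) 4 (by decide) 1 (by decide) 3 (by decide)
  have a₄ := h 0 0 (by decide) 4 (by decide) 3 (by decide) 5 (by decide)
  have n₁ : f 0 ≠ f 1 := hf.ne (by decide)
  have n₂ : f 2 ≠ f 3 := hf.ne (by decide)
  have n₃ : f 4 ≠ f 5 := hf.ne (by decide)
  have n₄ : f 0 ≠ f 2 := hf.ne (by decide)
  have n₅ : f 0 ≠ f 4 := hf.ne (by decide)
  have n₆ : f 2 ≠ f 4 := hf.ne (by decide)
  have n₇ : f 1 ≠ f 2 := hf.ne (by decide)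
  have n₈ : f 1 ≠ f 4 := hf.ne (by decide)
  have n₉ : f 3 ≠ f 0 := hf.ne (by decide)
  have n₁₀ : f 3 ≠ f 4 := hf.ne (by decide)
  have n₁₁ : f 5 ≠ f 0 := hf.ne (by decide)
  have n₁₂ : f 5 ≠ f 2 := hf.ne (by decide)
  unfold NoCross at *
  generalize f 0 = x0 at *
  generalize f 1 = x1 at *
  generalize f 2 = x2 at *
  generalize f 3 = x3 at *
  generalize f 4 = x4 at *
  generalize f 5 = x5 at *
  clear h hf
  grind

theorem WordRepresents.idxOf_injective {V : Type*} [DecidableEq V] {G : SimpleGraph V}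
    {w : List V} (hw : WordRepresents G w) : Function.Injective fun v => w.idxOf v :=
  fun u _ h => (List.idxOf_inj (hw.1 u)).1 h

/-- The clique neighbours and non-neighbours of a vertex do not separate each other in the
cyclic order in which the clique first occurs in a representing word. -/
theorem WordRepresents.noCross {V : Type*} [DecidableEq V] {G : SimpleGraph V} {w : List V}
    (hw : WordRepresents G w) {K : Set V} (hK : G.IsClique K) {x n n' m m' : V} (hx : x ∉ K)
    (hnK : n ∈ K) (hnK' : n' ∈ K) (hmK : m ∈ K) (hmK' : m' ∈ K) (hn : G.Adj x n)
    (hn' : G.Adj x n') (hm : ¬ G.Adj x m) (hm' : ¬ G.Adj x m') :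
    NoCross (w.idxOf n) (w.idxOf n') (w.idxOf m) (w.idxOf m') := by
  have adj_iff : ∀ v ∈ K, G.Adj x v ↔ Leads w x v ∨ Leads w v x := fun v hv => by
    have hxv : x ≠ v := fun h => hx (h ▸ hv)
    rw [← hw.2 x v hxv, alternates_iff_leads hxv]
  have lead : ∀ u ∈ K, ∀ v ∈ K, w.idxOf u < w.idxOf v → Leads w u v := fun u hu v hv huv => by
    have hne : u ≠ v := by
      rintro rfl
      exact huv.false
    exact ((hw.2 u v hne).2 (hK hu hv hne)).leads_of_idxOf_lt (hw.1 u) huv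
  have ne : ∀ u v, G.Adj x u → ¬ G.Adj x v → w.idxOf u ≠ w.idxOf v := fun u v hu hv h =>
    hv (hw.idxOf_injective h ▸ hu)
  have outer : ∀ p ∈ K, ∀ q ∈ K, ∀ r ∈ K, ∀ s ∈ K, G.Adj x p → G.Adj x r → ¬ G.Adj x q →
      ¬ G.Adj x s → ¬ (w.idxOf p < w.idxOf q ∧ w.idxOf q < w.idxOf r ∧ w.idxOf r < w.idxOf s) := by
    rintro p hp q hq r hr s hs ap ar aq as ⟨h₁, h₂, h₃⟩
    rw [adj_iff _ ‹_›] at ap ar aq as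
    exact (alternates_second_or_fourth (lead _ hp _ hq h₁) (lead _ hq _ hr h₂)
      (lead _ hr _ hs h₃) (lead _ hp _ hs (by omega)) ap ar).elim aq as
  have inner : ∀ p ∈ K, ∀ q ∈ K, ∀ r ∈ K, ∀ s ∈ K, ¬ G.Adj x p → ¬ G.Adj x r → G.Adj x q →
      G.Adj x s → ¬ (w.idxOf p < w.idxOf q ∧ w.idxOf q < w.idxOf r ∧ w.idxOf r < w.idxOf s) := by
    rintro p hp q hq r hr s hs ap ar aq as ⟨h₁, h₂, h₃⟩
    rw [adj_iff _ ‹_›] at ap ar aq as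
    exact (alternates_first_or_third (lead _ hp _ hq h₁) (lead _ hq _ hr h₂)
      (lead _ hr _ hs h₃) (lead _ hp _ hs (by omega)) aq as).elim ap ar
  by_contra h
  rcases not_noCross (ne _ _ hn hm) (ne _ _ hn hm') (ne _ _ hn' hm) (ne _ _ hn' hm') h with
    h | h | h | h | h | h | h | h
  · exact outer _ hnK _ hmK _ hnK' _ hmK' hn hn' hm hm' h
  · exact outer _ hnK _ hmK' _ hnK' _ hmK hn hn' hm' hm h
  · exact outer _ hnK' _ hmK _ hnK _ hmK' hn' hn hm hm' h
  · exact outer _ hnK' _ hmK' _ hnK _ hmK hn' hn hm' hm h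
  · exact inner _ hmK _ hnK _ hmK' _ hnK' hm hm' hn hn' h
  · exact inner _ hmK' _ hnK _ hmK _ hnK' hm' hm hn hn' h
  · exact inner _ hmK _ hnK' _ hmK' _ hnK hm hm' hn' hn h
  · exact inner _ hmK' _ hnK' _ hmK _ hnK hm' hm hn' hn h

theorem D1_adj_inr_inl (k : Fin 4) (i : Fin 6) :
    D1.Adj (Sum.inr k) (Sum.inl i) ↔ i ∈ D1nbr k := by
  simp [D1]

theorem D1_isClique_range_inl : D1.IsClique (Set.range Sum.inl) := by
  rintro _ ⟨i, rfl⟩ _ ⟨j, rfl⟩ hij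
  simpa [D1] using hij

/-- The graph `D₁` is not word-representable. -/
theorem stmt9 : ¬ WordRepresentable D1 := by
  rintro ⟨w, hw⟩
  refine false_of_noCross_D1nbr _ (hw.idxOf_injective.comp Sum.inl_injective) ?_
  intro k n hn n' hn' m hm m' hm'
  rw [← D1_adj_inr_inl] at hn hn' hm hm'
  exact hw.noCross D1_isClique_range_inl (by simp) ⟨n, rfl⟩ ⟨n', rfl⟩ ⟨m, rfl⟩ ⟨m', rfl⟩
    hn hn' hm hm'
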